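/- Every vector bundle of rank n ≥ 1 on P^1 over a field is isomorphic to a direct sum O(d_1) ⊕ ⋯ ⊕ O(d_n) for a unique non-decreasing sequence of integers d_1 ≤ ⋯ ≤ d_n (Grothendieck/Dedekind–Weber splitting theorem). -/

import Mathlib

open LaurentPolynomial

namespace Birkhoff

variable {k : Type} [Field k] {n : ℕ}

/-- `P` and its inverse both have entries in the subalgebra `S`. -/
def InS (S : Subalgebra k (LaurentPolynomial k)) (P : GL (Fin n) (LaurentPolynomial k)) : Prop :=
  (∀ i j, (P : Matrix (Fin n) (Fin n) (LaurentPolynomial k)) i j ∈ S) ∧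
  (∀ i j, ((P⁻¹ : GL (Fin n) (LaurentPolynomial k)) :
    Matrix (Fin n) (Fin n) (LaurentPolynomial k)) i j ∈ S)

theorem InS.inv {S : Subalgebra k (LaurentPolynomial k)} {P : GL (Fin n) (LaurentPolynomial k)}
    (h : InS S P) : InS S P⁻¹ := ⟨h.2, by simpa using h.1⟩

theorem InS.mul {S : Subalgebra k (LaurentPolynomial k)} {P Q : GL (Fin n) (LaurentPolynomial k)}
    (h : InS S P) (h' : InS S Q) : InS S (P * Q) := by
  constructor
  · intro i j
    rw [Units.val_mul, Matrix.mul_apply]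
    exact sum_mem fun l _ => mul_mem (h.1 _ _) (h'.1 _ _)
  · intro i j
    rw [mul_inv_rev, Units.val_mul, Matrix.mul_apply]
    exact sum_mem fun l _ => mul_mem (h'.2 _ _) (h.2 _ _)

theorem det_mem (S : Subalgebra k (LaurentPolynomial k))
    (M : Matrix (Fin n) (Fin n) (LaurentPolynomial k)) (h : ∀ i j, M i j ∈ S) : M.det ∈ S := by
  rw [Matrix.det_apply]
  refine sum_mem fun σ _ => ?_
  rw [Units.smul_def]
  exact zsmul_mem (prod_mem fun i _ => h _ _) _

theorem exists_inS (S : Subalgebra k (LaurentPolynomial k))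
    (M : Matrix (Fin n) (Fin n) (LaurentPolynomial k)) (h : ∀ i j, M i j ∈ S)
    (a : k) (ha : a ≠ 0) (hdet : M.det = algebraMap k _ a) :
    ∃ P : GL (Fin n) (LaurentPolynomial k), InS S P ∧
      (P : Matrix (Fin n) (Fin n) (LaurentPolynomial k)) = M := by
  have h1 : algebraMap k (LaurentPolynomial k) a * algebraMap k _ a⁻¹ = 1 := by
    rw [← map_mul, mul_inv_cancel₀ ha, map_one]
  have h2 : algebraMap k (LaurentPolynomial k) a⁻¹ * algebraMap k _ a = 1 := by
    rw [mul_comm, h1]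
  refine ⟨⟨M, algebraMap k (LaurentPolynomial k) a⁻¹ • M.adjugate, ?_, ?_⟩, ⟨h, ?_⟩, rfl⟩
  · rw [Matrix.mul_smul, Matrix.mul_adjugate, hdet, smul_smul, h2, one_smul]
  · rw [Matrix.smul_mul, Matrix.adjugate_mul, hdet, smul_smul, h2, one_smul]
  · intro i j
    change (algebraMap k (LaurentPolynomial k) a⁻¹ • M.adjugate) i j ∈ S
    rw [Matrix.smul_apply, smul_eq_mul]
    refine mul_mem (S.algebraMap_mem _) ?_
    rw [Matrix.adjugate_apply]
    refine det_mem S _ fun r s => ?_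
    rw [Matrix.updateRow_apply]
    split_ifs
    · rw [Pi.single_apply]
      split_ifs
      exacts [one_mem _, zero_mem _]
    · exact h _ _

/-- The embedding of polynomials as polynomials in `T⁻¹`. -/
noncomputable def phi (k : Type) [Field k] : Polynomial k →ₐ[k] LaurentPolynomial k :=
  (invert (R := k)).toAlgHom.comp Polynomial.toLaurentAlg

theorem phi_apply (p : Polynomial k) : phi k p = invert (Polynomial.toLaurent p) := rfl

theorem phi_X : phi k Polynomial.X = T (-1) := by
  rw [phi_apply, Polynomial.toLaurent_X, invert_T]

theorem phi_C (a : k) : phi k (Polynomial.C a) = C a := by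
  rw [phi_apply, Polynomial.toLaurent_C, invert_C]

theorem phi_inj : Function.Injective (phi k) := fun p q h =>
  Polynomial.toLaurent_injective (invert.injective h)

theorem mem_minus_iff (f : LaurentPolynomial k) :
    f ∈ Algebra.adjoin k {(T (-1) : LaurentPolynomial k)} ↔ ∃ p, phi k p = f := by
  have : phi k = Polynomial.aeval (T (-1)) := by
    apply Polynomial.algHom_ext
    rw [phi_X, Polynomial.aeval_X]
  rw [Algebra.adjoin_singleton_eq_range_aeval, ← this]
  rfl

theorem mem_plus_iff (f : LaurentPolynomial k) :
    f ∈ Algebra.adjoin k {(T 1 : LaurentPolynomial k)} ↔ ∃ p, Polynomial.toLaurent p = f := by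
  have : (Polynomial.toLaurentAlg : Polynomial k →ₐ[k] _) = Polynomial.aeval (T 1) := by
    apply Polynomial.algHom_ext
    rw [Polynomial.toLaurentAlg_apply, Polynomial.toLaurent_X, Polynomial.aeval_X]
  rw [Algebra.adjoin_singleton_eq_range_aeval, ← this]
  rfl

theorem exists_phi (f : LaurentPolynomial k) : ∃ N : ℕ, ∀ M : ℕ, N ≤ M →
    ∃ p, phi k p = f * T (-(M : ℤ)) := by
  obtain ⟨N, p, hp⟩ := exists_T_pow (invert f)
  refine ⟨N, fun M hM => ⟨p * Polynomial.X ^ (M - N), ?_⟩⟩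
  rw [phi_apply, map_mul, hp, Polynomial.toLaurent_X_pow, mul_assoc, ← T_add, map_mul, invert_T,
    Nat.cast_sub hM]
  congr 2
  · exact involutive_invert f
  · ring

/-- One reduction step. -/
theorem reduce (A : Matrix (Fin n) (Fin n) (LaurentPolynomial k)) (s : ℕ) :
    ∀ (P : GL (Fin n) (LaurentPolynomial k)) (d : Fin n → ℤ)
      (q : Matrix (Fin n) (Fin n) (Polynomial k)) (c : k),
      InS (Algebra.adjoin k {T 1}) P → c ≠ 0 →
      q.det = Polynomial.C c * Polynomial.X ^ s →
      A = (P : Matrix (Fin n) (Fin n) (LaurentPolynomial k)) *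
        (Matrix.diagonal (fun i => T (d i)) * q.map (phi k)) →
    ∃ (P : GL (Fin n) (LaurentPolynomial k)) (d : Fin n → ℤ)
      (q : Matrix (Fin n) (Fin n) (Polynomial k)) (c : k),
      InS (Algebra.adjoin k {T 1}) P ∧ c ≠ 0 ∧
      q.det = Polynomial.C c ∧
      A = (P : Matrix (Fin n) (Fin n) (LaurentPolynomial k)) *
        (Matrix.diagonal (fun i => T (d i)) * q.map (phi k)) := by
  induction s with
  | zero =>
    intro P d q c hP hc hq hA
    exact ⟨P, d, q, c, hP, hc, by simpa using hq, hA⟩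
  | succ s ih =>
    intro P d q c hP hc hq hA
    have h0 : (q.map (Polynomial.evalRingHom (0 : k))).det = 0 := by
      have := (RingHom.map_det (Polynomial.evalRingHom (0 : k)) q).symm
      rw [RingHom.mapMatrix_apply] at this
      rw [this, hq]
      simp
    obtain ⟨v, hv, hv0⟩ := Matrix.exists_vecMul_eq_zero_iff.mpr h0
    obtain ⟨i, hi, hmax⟩ : ∃ i, v i ≠ 0 ∧ ∀ j, v j ≠ 0 → d j ≤ d i := by
      obtain ⟨i0, hi0⟩ := Function.ne_iff.mp hv
      classical
      obtain ⟨i, hi, h⟩ := Finset.exists_max_image (Finset.univ.filter fun j => v j ≠ 0) d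
        ⟨i0, by simpa using hi0⟩
      exact ⟨i, by simpa using hi, fun j hj => h j (by simpa using hj)⟩
    have hw : ∀ l, ∃ w, ∑ j, Polynomial.C (v j) * q j l = Polynomial.X * w := by
      intro l
      have : Polynomial.X ∣ ∑ j, Polynomial.C (v j) * q j l := by
        rw [Polynomial.X_dvd_iff, Polynomial.coeff_zero_eq_eval_zero]
        have := congrFun hv0 l
        simpa [Matrix.vecMul, dotProduct, Polynomial.eval_finsetSum] using this
      exact this
    choose w hw using hw
    have hqd : Polynomial.X * (q.updateRow i w).det = Polynomial.C (v i) * q.det := by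
      rw [← Matrix.det_updateRow_smul, ← smul_eq_mul (Polynomial.C (v i)),
        ← Matrix.det_updateRow_sum q i (fun j => Polynomial.C (v j))]
      congr 2
      ext1 l
      simp [← hw, Finset.sum_apply]
    have hdet' : (q.updateRow i w).det = Polynomial.C (v i * c) * Polynomial.X ^ s := by
      apply mul_left_cancel₀ (Polynomial.X_ne_zero (R := k))
      rw [hqd, hq, Polynomial.C_mul]
      ring
    let u : Fin n → LaurentPolynomial k := fun j => C (v j) * T (d i - d j)
    obtain ⟨E, hE, hEe⟩ := exists_inS (Algebra.adjoin k {(T 1 : LaurentPolynomial k)})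
      ((1 : Matrix (Fin n) (Fin n) (LaurentPolynomial k)).updateRow i u)
      (by
        intro r l
        rw [Matrix.updateRow_apply]
        split_ifs
        · by_cases hl : v l = 0
          · simp [u, hl]
          · rw [mem_plus_iff]
            refine ⟨Polynomial.C (v l) * Polynomial.X ^ (d i - d l).toNat, ?_⟩
            rw [Polynomial.toLaurent_C_mul_X_pow, Int.toNat_of_nonneg]
            linarith [hmax l hl]
        · rw [Matrix.one_apply]
          split_ifs
          exacts [one_mem _, zero_mem _])
      (v i) hi (by
        rw [← Matrix.cramer_transpose_apply, Matrix.transpose_one, Matrix.cramer_one]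
        simp [u])
    refine ih (P * E⁻¹) (Function.update d i (d i - 1)) (q.updateRow i w) (v i * c)
      (hP.mul hE.inv) (mul_ne_zero hi hc) hdet' ?_
    have key : (E : Matrix (Fin n) (Fin n) (LaurentPolynomial k)) *
        (Matrix.diagonal (fun i => T (d i)) * q.map (phi k)) =
        Matrix.diagonal (fun j => T (Function.update d i (d i - 1) j)) *
          (q.updateRow i w).map (phi k) := by
      rw [hEe]
      ext1 r l
      rw [Matrix.diagonal_mul, Matrix.map_apply, Matrix.mul_apply]
      by_cases hr : r = i
      · subst hr
        simp only [Matrix.updateRow_self, Matrix.diagonal_mul, Matrix.map_apply,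
          Function.update_self]
        have h3 : T (d r - 1) * phi k (w l) = T (d r) * phi k (Polynomial.X * w l) := by
          rw [map_mul, phi_X, ← mul_assoc, ← T_add, sub_eq_add_neg]
        rw [h3, ← hw, map_sum, Finset.mul_sum]
        refine Finset.sum_congr rfl fun j _ => ?_
        rw [map_mul, phi_C]
        have h4 : (T (d r) : LaurentPolynomial k) = T (d r - d j) * T (d j) := by
          rw [← T_add]; congr 1; ring
        rw [h4]
        simp only [u]
        ring
      · simp only [Matrix.updateRow_ne hr, Function.update_of_ne hr, Matrix.diagonal_mul,
          Matrix.map_apply, Matrix.one_apply]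
        simp
    rw [← key, Units.val_mul, mul_assoc, ← mul_assoc (((E⁻¹ : GL (Fin n) (LaurentPolynomial k)) :
      Matrix (Fin n) (Fin n) (LaurentPolynomial k))), ← Units.val_mul, inv_mul_cancel,
      Units.val_one, one_mul, hA]

theorem det_map_phi (q : Matrix (Fin n) (Fin n) (Polynomial k)) :
    (q.map (phi k)).det = phi k q.det := by
  have := (RingHom.map_det (phi k).toRingHom q).symm
  exact this

theorem init (A : GL (Fin n) (LaurentPolynomial k)) :
    ∃ (N : ℕ) (q : Matrix (Fin n) (Fin n) (Polynomial k)) (c : k) (s : ℕ), c ≠ 0 ∧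
      q.det = Polynomial.C c * Polynomial.X ^ s ∧
      (A : Matrix (Fin n) (Fin n) (LaurentPolynomial k)) =
        Matrix.diagonal (fun _ => T (N : ℤ)) * q.map (phi k) := by
  choose N hN using fun i j =>
    exists_phi ((A : Matrix (Fin n) (Fin n) (LaurentPolynomial k)) i j)
  let M : ℕ := ∑ i, ∑ j, N i j
  have hM : ∀ i j, N i j ≤ M := fun i j =>
    (Finset.single_le_sum (f := fun j => N i j) (fun _ _ => Nat.zero_le _)
      (Finset.mem_univ j)).trans
    (Finset.single_le_sum (f := fun i => ∑ j, N i j) (fun _ _ => Nat.zero_le _)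
      (Finset.mem_univ i))
  choose q hq using fun i j => hN i j M (hM i j)
  have hA : (A : Matrix (Fin n) (Fin n) (LaurentPolynomial k)) =
      Matrix.diagonal (fun _ => T (M : ℤ)) * (Matrix.of q).map (phi k) := by
    ext1 i j
    rw [Matrix.diagonal_mul, Matrix.map_apply, Matrix.of_apply, hq, mul_comm, mul_assoc, ← T_add]
    simp
  have hu : IsUnit (phi k (Matrix.of q).det) := by
    have h1 : IsUnit (A : Matrix (Fin n) (Fin n) (LaurentPolynomial k)).det :=
      (Matrix.isUnit_iff_isUnit_det _).mp A.isUnit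
    rw [hA, Matrix.det_mul, det_map_phi] at h1
    exact isUnit_of_mul_isUnit_right h1
  obtain ⟨g, hg⟩ := hu.exists_right_inv
  obtain ⟨L, hL⟩ := exists_phi g
  obtain ⟨p, hp⟩ := hL L le_rfl
  have hdvd : (Matrix.of q).det ∣ Polynomial.X ^ L := by
    refine ⟨p, phi_inj ?_⟩
    rw [map_mul, hp, ← mul_assoc, hg, one_mul, map_pow, phi_X, T_pow]
    congr 1; ring
  obtain ⟨s, -, hs⟩ := (dvd_prime_pow Polynomial.prime_X L).mp hdvd
  obtain ⟨t, ht⟩ := hs.symm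
  obtain ⟨c, hc, hct⟩ := Polynomial.isUnit_iff.mp t.isUnit
  exact ⟨M, Matrix.of q, c, s, hc.ne_zero, by rw [← ht, ← hct, mul_comm], hA⟩

theorem existence (A : GL (Fin n) (LaurentPolynomial k)) :
    ∃ d : Fin n → ℤ, Monotone d ∧ ∃ P Q : GL (Fin n) (LaurentPolynomial k),
      InS (Algebra.adjoin k {T 1}) P ∧ InS (Algebra.adjoin k {T (-1)}) Q ∧
      (A : Matrix (Fin n) (Fin n) (LaurentPolynomial k)) =
          (P : Matrix (Fin n) (Fin n) (LaurentPolynomial k)) *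
            Matrix.diagonal (fun i => T (d i)) *
            (Q : Matrix (Fin n) (Fin n) (LaurentPolynomial k)) := by
  obtain ⟨N, q, c, s, hc, hdet, hA⟩ := init A
  obtain ⟨P, d, q, c, hP, hc, hdet, hA⟩ := reduce A.val s 1 (fun _ => (N : ℤ)) q c
    ⟨fun i j => by
      rw [Units.val_one, Matrix.one_apply]; split_ifs
      exacts [one_mem _, zero_mem _],
     fun i j => by
      rw [inv_one, Units.val_one, Matrix.one_apply]; split_ifs
      exacts [one_mem _, zero_mem _]⟩ hc hdet
    (by rw [Units.val_one, one_mul]; exact hA)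
  obtain ⟨Q, hQ, hQe⟩ := exists_inS (Algebra.adjoin k {(T (-1) : LaurentPolynomial k)})
    (q.map (phi k)) (fun i j => (mem_minus_iff _).mpr ⟨_, rfl⟩) c hc
    (by rw [det_map_phi, hdet, phi_C]; rfl)
  let σ := Tuple.sort d
  have hperm : ∀ S : Subalgebra k (LaurentPolynomial k), ∀ τ : Equiv.Perm (Fin n),
      ∃ W : GL (Fin n) (LaurentPolynomial k), InS S W ∧
      (W : Matrix (Fin n) (Fin n) (LaurentPolynomial k)) =
        (1 : Matrix (Fin n) (Fin n) (LaurentPolynomial k)).submatrix τ id := by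
    intro S τ
    refine exists_inS S _ (fun i j => ?_) ((Equiv.Perm.sign τ : ℤ) : k) ?_ ?_
    · rw [Matrix.submatrix_apply, Matrix.one_apply]; split_ifs
      exacts [one_mem _, zero_mem _]
    · rcases Int.units_eq_one_or (Equiv.Perm.sign τ) with h | h <;> simp [h]
    · rw [Matrix.det_permute, Matrix.det_one, mul_one, map_intCast]
  obtain ⟨W, hW, hWe⟩ := hperm (Algebra.adjoin k {(T 1 : LaurentPolynomial k)}) σ.symm
  obtain ⟨V, hV, hVe⟩ := hperm (Algebra.adjoin k {(T (-1) : LaurentPolynomial k)}) σ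
  refine ⟨d ∘ σ, Tuple.monotone_sort d, P * W, V * Q, hP.mul hW, hV.mul hQ, ?_⟩
  rw [hA, Units.val_mul, Units.val_mul, hWe, hVe, hQe]
  have : Matrix.diagonal (fun i => (T (d i) : LaurentPolynomial k)) =
      (1 : Matrix (Fin n) (Fin n) (LaurentPolynomial k)).submatrix σ.symm id *
      Matrix.diagonal (fun i => T ((d ∘ σ) i)) *
      (1 : Matrix (Fin n) (Fin n) (LaurentPolynomial k)).submatrix σ id := by
    ext1 i j
    rw [Matrix.mul_apply]
    simp only [Matrix.mul_diagonal, Matrix.submatrix_apply, Matrix.one_apply, id,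
      Matrix.diagonal_apply, Function.comp]
    simp only [ite_mul, one_mul, zero_mul, Finset.sum_ite_eq, Finset.mem_univ, if_true,
      Equiv.apply_symm_apply]
    simp
  rw [this]
  simp only [mul_assoc]

theorem deg_le (p : LaurentPolynomial k) (q : LaurentPolynomial k)
    (hp : p ∈ Algebra.adjoin k {(T 1 : LaurentPolynomial k)})
    (hq : q ∈ Algebra.adjoin k {(T (-1) : LaurentPolynomial k)}) (hp0 : p ≠ 0) (a b : ℤ)
    (h : p * T a = T b * q) : a ≤ b := by
  by_contra hab
  push Not at hab
  obtain ⟨p, rfl⟩ := (mem_plus_iff _).mp hp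
  obtain ⟨q, rfl⟩ := (mem_minus_iff _).mp hq
  have hp0' : p ≠ 0 := by rintro rfl; simp at hp0
  obtain ⟨m, hm⟩ := Int.eq_ofNat_of_zero_le (sub_nonneg.mpr hab.le)
  have h1 : p * Polynomial.X ^ (m + q.natDegree) = q.reverse := by
    apply Polynomial.toLaurent_injective
    rw [toLaurent_reverse, ← phi_apply, map_mul, Polynomial.toLaurent_X_pow]
    have h2 : phi k q = Polynomial.toLaurent p * T (a - b) := by
      rw [sub_eq_add_neg, T_add, ← mul_assoc, h, mul_comm (T b), mul_assoc, ← T_add]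
      simp
    rw [h2, mul_assoc, ← T_add, hm]
    push_cast
    rfl
  have h3 := congrArg Polynomial.natDegree h1
  rw [Polynomial.natDegree_mul_X_pow _ hp0'] at h3
  have h4 := Polynomial.reverse_natDegree_le q
  omega

theorem le_of_eq (A : GL (Fin n) (LaurentPolynomial k)) (d d' : Fin n → ℤ) (hd : Monotone d)
    (hd' : Monotone d') (P Q P' Q' : GL (Fin n) (LaurentPolynomial k))
    (hP : InS (Algebra.adjoin k {T 1}) P) (hQ : InS (Algebra.adjoin k {T (-1)}) Q)
    (hP' : InS (Algebra.adjoin k {T 1}) P') (hQ' : InS (Algebra.adjoin k {T (-1)}) Q')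
    (h : (A : Matrix (Fin n) (Fin n) (LaurentPolynomial k)) =
          (P : Matrix (Fin n) (Fin n) (LaurentPolynomial k)) *
            Matrix.diagonal (fun i => T (d i)) *
            (Q : Matrix (Fin n) (Fin n) (LaurentPolynomial k)))
    (h' : (A : Matrix (Fin n) (Fin n) (LaurentPolynomial k)) =
          (P' : Matrix (Fin n) (Fin n) (LaurentPolynomial k)) *
            Matrix.diagonal (fun i => T (d' i)) *
            (Q' : Matrix (Fin n) (Fin n) (LaurentPolynomial k))) : d ≤ d' := by
  have hU := hP'.inv.mul hP
  have hV := hQ'.mul hQ.inv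
  have hUV : ((P'⁻¹ * P : GL (Fin n) (LaurentPolynomial k)) :
        Matrix (Fin n) (Fin n) (LaurentPolynomial k)) * Matrix.diagonal (fun i => T (d i)) =
      Matrix.diagonal (fun i => T (d' i)) * ((Q' * Q⁻¹ : GL (Fin n) (LaurentPolynomial k)) :
        Matrix (Fin n) (Fin n) (LaurentPolynomial k)) := by
    rw [Units.val_mul, Units.val_mul, mul_assoc, Units.inv_mul_eq_iff_eq_mul, ← mul_assoc,
      ← mul_assoc, Units.eq_mul_inv_iff_mul_eq, ← h, ← h']
  have hle : ∀ i j, ((P'⁻¹ * P : GL (Fin n) (LaurentPolynomial k)) :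
        Matrix (Fin n) (Fin n) (LaurentPolynomial k)) i j ≠ 0 → d j ≤ d' i := by
    intro i j hij
    refine deg_le _ _ (hU.1 i j) (hV.1 i j) hij _ _ ?_
    have := congrFun (congrFun hUV i) j
    rwa [Matrix.mul_diagonal, Matrix.diagonal_mul] at this
  obtain ⟨σ, hσ⟩ : ∃ σ : Equiv.Perm (Fin n), ∀ j, d j ≤ d' (σ j) := by
    by_contra hcon
    push Not at hcon
    have h1 : IsUnit ((P'⁻¹ * P : GL (Fin n) (LaurentPolynomial k)) :
        Matrix (Fin n) (Fin n) (LaurentPolynomial k)).det :=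
      (Matrix.isUnit_iff_isUnit_det _).mp (P'⁻¹ * P).isUnit
    apply h1.ne_zero
    rw [Matrix.det_apply]
    refine Finset.sum_eq_zero fun σ _ => ?_
    obtain ⟨j, hj⟩ := hcon σ
    rw [Finset.prod_eq_zero (Finset.mem_univ j), smul_zero]
    by_contra hne
    exact absurd (hle _ _ hne) (not_le.mpr hj)
  intro i
  by_contra hi
  push Not at hi
  have hmaps : ∀ j ∈ Finset.Ici i, σ j ∈ Finset.Ioi i := by
    intro j hj
    rw [Finset.mem_Ici] at hj
    rw [Finset.mem_Ioi]
    by_contra hc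
    have h1 := hd' (not_lt.mp hc)
    have h2 := hd hj
    have h3 := hσ j
    linarith
  have hcard := Finset.card_le_card_of_injOn σ hmaps σ.injective.injOn
  have hlt : (Finset.Ioi i).card < (Finset.Ici i).card :=
    Finset.card_lt_card ⟨Finset.Ioi_subset_Ici_self, fun hh => by
      have := hh (Finset.mem_Ici.mpr le_rfl)
      simp at this⟩
  omega

end Birkhoff


/-- Grothendieck/Dedekind–Weber splitting theorem: every vector bundle of
rank `n ≥ 1` on `P¹` over a field `k` is isomorphic to `O(d₁) ⊕ ⋯ ⊕ O(dₙ)` for a unique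
non-decreasing sequence of integers `d₁ ≤ ⋯ ≤ dₙ`.  A rank `n` vector bundle on `P¹` is,
via its gluing datum on the standard affine cover, a matrix `A ∈ GLₙ(k[T,T⁻¹])` taken
modulo `GLₙ(k[T])` on the left and `GLₙ(k[T⁻¹])` on the right, and the splitting theorem
is exactly Birkhoff factorization: `A = P · diag(T^{d₁},…,T^{dₙ}) · Q` with `P, P⁻¹`
having entries in `k[T]` and `Q, Q⁻¹` entries in `k[T⁻¹]`, with `d` unique among
non-decreasing integer sequences. -/
theorem stmt_2 (k : Type) [Field k] (n : ℕ) (hn : 1 ≤ n)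
    (A : GL (Fin n) (LaurentPolynomial k)) :
    ∃! d : Fin n → ℤ, Monotone d ∧
      ∃ P Q : GL (Fin n) (LaurentPolynomial k),
        (∀ i j, (P : Matrix (Fin n) (Fin n) (LaurentPolynomial k)) i j ∈
            Algebra.adjoin k {(T 1 : LaurentPolynomial k)}) ∧
        (∀ i j, ((P⁻¹ : GL (Fin n) (LaurentPolynomial k)) :
            Matrix (Fin n) (Fin n) (LaurentPolynomial k)) i j ∈
            Algebra.adjoin k {(T 1 : LaurentPolynomial k)}) ∧
        (∀ i j, (Q : Matrix (Fin n) (Fin n) (LaurentPolynomial k)) i j ∈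
            Algebra.adjoin k {(T (-1) : LaurentPolynomial k)}) ∧
        (∀ i j, ((Q⁻¹ : GL (Fin n) (LaurentPolynomial k)) :
            Matrix (Fin n) (Fin n) (LaurentPolynomial k)) i j ∈
            Algebra.adjoin k {(T (-1) : LaurentPolynomial k)}) ∧
        (A : Matrix (Fin n) (Fin n) (LaurentPolynomial k)) =
          (P : Matrix (Fin n) (Fin n) (LaurentPolynomial k)) *
            Matrix.diagonal (fun i => T (d i)) *
            (Q : Matrix (Fin n) (Fin n) (LaurentPolynomial k)) := by
  obtain ⟨d, hd, P, Q, hP, hQ, hA⟩ := Birkhoff.existence A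
  refine ⟨d, ⟨hd, P, Q, hP.1, hP.2, hQ.1, hQ.2, hA⟩, ?_⟩
  rintro d' ⟨hd', P', Q', h1, h2, h3, h4, hA'⟩
  exact le_antisymm
    (Birkhoff.le_of_eq A d' d hd' hd P' Q' P Q ⟨h1, h2⟩ ⟨h3, h4⟩ hP hQ hA' hA)
    (Birkhoff.le_of_eq A d d' hd hd' P Q P' Q' hP hQ ⟨h1, h2⟩ ⟨h3, h4⟩ hA hA')
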